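/- The function τ(θ) = 1 + (4/θ) · ( (1/θ) · ∫₀^θ t/(exp(t)−1) dt − 1 ) satisfies lim_{θ→+∞} τ(θ) = 1 and lim_{θ→−∞} τ(θ) = −1, so the Frank copula family attains rank correlations arbitrarily close to both perfect positive and perfect negative dependence. -/

import Mathlib

/-- The integrand `t ↦ t/(exp t − 1)`, extended continuously by `1` at `t = 0`. -/
noncomputable def debyeIntegrand (t : ℝ) : ℝ :=
  if t = 0 then 1 else t / (Real.exp t - 1)

/-- Kendall's rank correlation coefficient of the Frank copula with association
parameter `θ ≠ 0`; for `θ < 0` the integral `∫₀^θ` is the oriented (interval) integral. -/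
noncomputable def frankTau (θ : ℝ) : ℝ :=
  1 + (4 / θ) * ((1 / θ) * (∫ t in (0 : ℝ)..θ, debyeIntegrand t) - 1)

lemma debye_bound (t : ℝ) (ht : 0 ≤ t) : ‖debyeIntegrand t‖ ≤ 1 := by
  unfold debyeIntegrand
  split_ifs with h
  · simp
  · have h1 : 0 < t := lt_of_le_of_ne ht (Ne.symm h)
    have h2 := Real.add_one_le_exp t
    rw [Real.norm_of_nonneg (div_nonneg ht (by linarith)), div_le_one (by linarith)]
    linarith

lemma debye_neg (t : ℝ) : debyeIntegrand (-t) = debyeIntegrand t + t := by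
  unfold debyeIntegrand
  by_cases h : t = 0
  · simp [h]
  · have h1 : Real.exp t - 1 ≠ 0 := by
      rw [sub_ne_zero]; simpa using h
    have h2 : 1 - Real.exp t ≠ 0 := by
      intro h3; apply h1; linarith
    have h4 : Real.exp t ≠ 0 := Real.exp_ne_zero t
    have h5 : Real.exp (-t) - 1 = (1 - Real.exp t) / Real.exp t := by
      rw [Real.exp_neg]; field_simp
    simp only [neg_eq_zero, h, if_false]
    rw [h5, show 1 - Real.exp t = -(Real.exp t - 1) by ring]
    field_simp
    ring

lemma debye_meas : Measurable debyeIntegrand := by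
  unfold debyeIntegrand
  exact Measurable.ite (measurableSet_singleton 0) measurable_const (by fun_prop)

lemma debye_int (x : ℝ) (hx : 0 ≤ x) :
    IntervalIntegrable debyeIntegrand MeasureTheory.volume 0 x := by
  rw [intervalIntegrable_iff_integrableOn_Ioc_of_le hx]
  refine MeasureTheory.Measure.integrableOn_of_bounded (M := 1) (by simp)
    debye_meas.aestronglyMeasurable ?_
  filter_upwards [MeasureTheory.ae_restrict_mem measurableSet_Ioc] with t ht
  exact debye_bound t ht.1.le

lemma frankTau_neg (x : ℝ) (hx : 0 < x) : frankTau (-x) = - frankTau x := by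
  have h : ∫ t in (0 : ℝ)..(-x), debyeIntegrand t
      = -((∫ t in (0 : ℝ)..x, debyeIntegrand t) + x ^ 2 / 2) := by
    have h1 := intervalIntegral.integral_comp_neg (a := 0) (b := x) debyeIntegrand
    rw [neg_zero] at h1
    rw [intervalIntegral.integral_symm, ← h1]
    simp only [debye_neg]
    rw [intervalIntegral.integral_add (debye_int x hx.le) (by simp), integral_id]
    ring
  unfold frankTau
  rw [h]
  field_simp
  ring

lemma frankTau_top : Filter.Tendsto frankTau Filter.atTop (nhds 1) := by
  have h0 : Filter.Tendsto (fun x : ℝ => 8 / x) Filter.atTop (nhds 0) :=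
    tendsto_const_nhds.div_atTop Filter.tendsto_id
  rw [tendsto_iff_norm_sub_tendsto_zero]
  refine squeeze_zero' (Filter.Eventually.of_forall fun _ => norm_nonneg _) ?_ h0
  filter_upwards [Filter.eventually_gt_atTop 0] with x hx
  have hb : ‖∫ t in (0 : ℝ)..x, debyeIntegrand t‖ ≤ 1 * |x - 0| := by
    apply intervalIntegral.norm_integral_le_of_norm_le_const
    intro t ht
    rw [Set.uIoc_of_le hx.le] at ht
    exact debye_bound t ht.1.le
  rw [sub_zero, abs_of_pos hx, one_mul] at hb
  unfold frankTau
  rw [add_sub_cancel_left, norm_mul, Real.norm_of_nonneg (by positivity : 0 ≤ 4 / x)]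
  have h2 : ‖(1 / x) * (∫ t in (0 : ℝ)..x, debyeIntegrand t) - 1‖ ≤ 2 := by
    refine (norm_sub_le _ _).trans ?_
    rw [norm_mul, Real.norm_of_nonneg (by positivity : 0 ≤ 1 / x), norm_one]
    have : 1 / x * ‖∫ t in (0 : ℝ)..x, debyeIntegrand t‖ ≤ 1 / x * x := by gcongr
    have h3 : 1 / x * x = 1 := by field_simp
    linarith
  calc _ ≤ 4 / x * 2 := by gcongr
    _ = 8 / x := by ring

/-- `τ(θ) → 1` as `θ → +∞` and `τ(θ) → −1` as `θ → −∞`: the Frank copula family attains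
rank correlations arbitrarily close to both perfect positive and negative dependence. -/
theorem frankTau_limits :
    Filter.Tendsto frankTau Filter.atTop (nhds 1) ∧
    Filter.Tendsto frankTau Filter.atBot (nhds (-1)) := by
  refine ⟨frankTau_top, ?_⟩
  have h := (frankTau_top.comp Filter.tendsto_neg_atBot_atTop).neg
  refine h.congr' ?_
  filter_upwards [Filter.eventually_lt_atBot 0] with x hx
  have := frankTau_neg (-x) (by linarith)
  rw [neg_neg] at this
  simp [this]
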